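/- Let (D',<) be a linear order, D ⊆ D', and let S = (S_x | x ∈ D) be a monotone family of semiintervals of (D,<). Then there exists a monotone family R = (R_x | x ∈ D') of semiintervals of (D',<) such that R_x ∩ D = S_x and R_x^n ∩ D = S_x^n for all x ∈ D and all n ≥ 1; moreover, R can be chosen so that for every x ∈ D, R_x is an R-shift if and only if S_x is an S-shift. -/

import Mathlib

namespace SemiIntervalFamilies

/-- The `n`-th power of a family of semiintervals, indexed so that `famPow S 1 x = S x`
and `famPow S (n+1) x = ⋃ t ∈ famPow S n x, S t`. -/
def famPow {D : Type*} (S : D → Set D) : ℕ → D → Set D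
  | 0, x => {x}
  | n + 1, x => ⋃ t ∈ famPow S n x, S t

/-- `S` is a family of semiintervals of the linear order `D`: each `S x` is convex
and has minimum element `x`. -/
def IsSemiIntervalFamily {D : Type*} [LinearOrder D] (S : D → Set D) : Prop :=
  ∀ x : D, (∀ a ∈ S x, ∀ b ∈ S x, ∀ c : D, a ≤ c → c ≤ b → c ∈ S x) ∧
    x ∈ S x ∧ (∀ y ∈ S x, x ≤ y)

/-- The smallest initial part of `D` containing `X`. -/
def supin {D : Type*} [LinearOrder D] (X : Set D) : Set D :=
  {d : D | ∃ x ∈ X, d ≤ x}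

/-- The family `S` is monotone if `x ≤ y` implies `supin (S x) ⊆ supin (S y)`. -/
def IsMonotoneFamily {D : Type*} [LinearOrder D] (S : D → Set D) : Prop :=
  ∀ x y : D, x ≤ y → supin (S x) ⊆ supin (S y)

/-- `S a` is a shift: the sequence of powers `(S_a^n)_{n ≥ 1}` is strictly
increasing under inclusion. -/
def IsShift {D : Type*} (S : D → Set D) (a : D) : Prop :=
  ∀ n : ℕ, 1 ≤ n → famPow S n a ⊂ famPow S (n + 1) a

/-- The convex hull of a subset of a linear order. -/
def conv {D : Type*} [LinearOrder D] (X : Set D) : Set D :=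
  {d : D | ∃ a ∈ X, ∃ b ∈ X, a ≤ d ∧ d ≤ b}

end SemiIntervalFamilies

open SemiIntervalFamilies

/-- The smallest initial part of the suborder `D` containing `X`. -/
def supinRel {D' : Type*} [LinearOrder D'] (D : Set D') (X : Set D') : Set D' :=
  {d : D' | d ∈ D ∧ ∃ x ∈ X, d ≤ x}

section Extension

variable {E : Type*} {D : Set E} {S : E → Set E}

theorem famPow_subset_of_subset (hsub : ∀ x ∈ D, S x ⊆ D) {x : E} (hx : x ∈ D) (n : ℕ) :
    famPow S n x ⊆ D := by
  induction n with
  | zero => exact Set.singleton_subset_iff.mpr hx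
  | succ n ih => exact Set.iUnion₂_subset fun t ht => hsub t (ih ht)

theorem famPow_subset_famPow_succ (hsub : ∀ x ∈ D, S x ⊆ D) (hmem : ∀ x ∈ D, x ∈ S x)
    {x : E} (hx : x ∈ D) (n : ℕ) : famPow S n x ⊆ famPow S (n + 1) x := fun w hw =>
  Set.mem_iUnion₂.mpr ⟨w, hw, hmem w (famPow_subset_of_subset hsub hx n hw)⟩

variable [LinearOrder E]

/-- The extension to the whole order of a family of semiintervals on `D`: the least choice
that contains the upper parts of all `S y` with `y ∈ D` below the base point. -/
def semiIntervalExtension (D : Set E) (S : E → Set E) (z : E) : Set E :=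
  {w | z ≤ w ∧ (w = z ∨ ∃ y ∈ D, y ≤ z ∧ ∃ s ∈ S y, w ≤ s)}

theorem isSemiIntervalFamily_semiIntervalExtension (D : Set E) (S : E → Set E) :
    IsSemiIntervalFamily (semiIntervalExtension D S) := by
  refine fun z => ⟨?_, ⟨le_rfl, Or.inl rfl⟩, fun y hy => hy.1⟩
  rintro a ha b ⟨-, hb⟩ c hac hcb
  refine ⟨ha.1.trans hac, ?_⟩
  rcases hb with rfl | ⟨y, hy, hyz, s, hs, hbs⟩
  · exact Or.inl (le_antisymm hcb (ha.1.trans hac))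
  · exact Or.inr ⟨y, hy, hyz, s, hs, hcb.trans hbs⟩

theorem isMonotoneFamily_semiIntervalExtension (D : Set E) (S : E → Set E) :
    IsMonotoneFamily (semiIntervalExtension D S) := by
  rintro x y hxy d ⟨w, ⟨-, hw⟩, hdw⟩
  rcases le_total w y with hwy | hyw
  · exact ⟨y, ⟨le_rfl, Or.inl rfl⟩, hdw.trans hwy⟩
  · rcases hw with rfl | ⟨u, hu, hux, s, hs, hws⟩
    · exact ⟨y, ⟨le_rfl, Or.inl rfl⟩, hdw.trans hxy⟩
    · exact ⟨w, ⟨hyw, Or.inr ⟨u, hu, hux.trans hxy, s, hs, hws⟩⟩, hdw⟩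

theorem exists_le_of_mem_semiIntervalExtension (hsub : ∀ x ∈ D, S x ⊆ D)
    (hmem : ∀ x ∈ D, x ∈ S x)
    (hmono : ∀ x ∈ D, ∀ y ∈ D, x ≤ y → supinRel D (S x) ⊆ supinRel D (S y))
    {t w y : E} (hy : y ∈ D) (hty : t ≤ y) (hw : w ∈ semiIntervalExtension D S t) :
    ∃ s ∈ S y, w ≤ s := by
  obtain ⟨-, rfl | ⟨u, hu, hut, s, hs, hws⟩⟩ := hw
  · exact ⟨y, hmem y hy, hty⟩
  · obtain ⟨-, s', hs', hss'⟩ := hmono u hu y hy (hut.trans hty) ⟨hsub u hu hs, s, hs, le_rfl⟩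
    exact ⟨s', hs', hws.trans hss'⟩

theorem le_of_mem_famPow (hsub : ∀ x ∈ D, S x ⊆ D) (hmin : ∀ x ∈ D, ∀ y ∈ S x, x ≤ y)
    {x : E} (hx : x ∈ D) (n : ℕ) {w : E} (hw : w ∈ famPow S n x) : x ≤ w := by
  induction n generalizing w with
  | zero => exact (Set.mem_singleton_iff.mp hw).ge
  | succ n ih =>
    obtain ⟨t, ht, hwt⟩ := Set.mem_iUnion₂.mp hw
    exact (ih ht).trans (hmin t (famPow_subset_of_subset hsub hx n ht) w hwt)

theorem mem_famPow_of_le (hsub : ∀ x ∈ D, S x ⊆ D)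
    (hconv : ∀ x ∈ D, ∀ a ∈ S x, ∀ b ∈ S x, ∀ c ∈ D, a ≤ c → c ≤ b → c ∈ S x)
    (hmem : ∀ x ∈ D, x ∈ S x) {x : E} (hx : x ∈ D) (n : ℕ) {c s : E} (hc : c ∈ D)
    (hxc : x ≤ c) (hs : s ∈ famPow S n x) (hcs : c ≤ s) : c ∈ famPow S n x := by
  induction n generalizing s with
  | zero =>
    obtain rfl := Set.mem_singleton_iff.mp hs
    exact Set.mem_singleton_iff.mpr (le_antisymm hcs hxc)
  | succ n ih =>
    obtain ⟨t, ht, hst⟩ := Set.mem_iUnion₂.mp hs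
    have htD := famPow_subset_of_subset hsub hx n ht
    rcases le_total c t with hct | htc
    · exact Set.mem_iUnion₂.mpr ⟨c, ih ht hct, hmem c hc⟩
    · exact Set.mem_iUnion₂.mpr ⟨t, ht, hconv t htD t (hmem t htD) s hst c hc htc hcs⟩

theorem mem_famPow_semiIntervalExtension_iff (hsub : ∀ x ∈ D, S x ⊆ D)
    (hmem : ∀ x ∈ D, x ∈ S x) (hmin : ∀ x ∈ D, ∀ y ∈ S x, x ≤ y)
    (hmono : ∀ x ∈ D, ∀ y ∈ D, x ≤ y → supinRel D (S x) ⊆ supinRel D (S y))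
    {x : E} (hx : x ∈ D) (n : ℕ) {w : E} :
    w ∈ famPow (semiIntervalExtension D S) n x ↔ x ≤ w ∧ ∃ s ∈ famPow S n x, w ≤ s := by
  induction n generalizing w with
  | zero =>
    constructor
    · intro hw
      obtain rfl := Set.mem_singleton_iff.mp hw
      exact ⟨le_rfl, w, rfl, le_rfl⟩
    · rintro ⟨hxw, s, rfl, hws⟩
      exact le_antisymm hws hxw
  | succ n ih =>
    constructor
    · intro hw
      obtain ⟨t, ht, hwt⟩ := Set.mem_iUnion₂.mp hw
      obtain ⟨hxt, s, hs, hts⟩ := ih.mp ht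
      obtain ⟨s', hs', hws'⟩ := exists_le_of_mem_semiIntervalExtension hsub hmem hmono
        (famPow_subset_of_subset hsub hx n hs) hts hwt
      exact ⟨hxt.trans hwt.1, s', Set.mem_iUnion₂.mpr ⟨s, hs, hs'⟩, hws'⟩
    · rintro ⟨hxw, s', hs', hws'⟩
      obtain ⟨s, hs, hss'⟩ := Set.mem_iUnion₂.mp hs'
      rcases le_total w s with hws | hsw
      · exact Set.mem_iUnion₂.mpr ⟨w, ih.mpr ⟨hxw, s, hs, hws⟩, le_rfl, Or.inl rfl⟩
      · have hsD := famPow_subset_of_subset hsub hx n hs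
        exact Set.mem_iUnion₂.mpr ⟨s, ih.mpr ⟨le_of_mem_famPow hsub hmin hx n hs, s, hs, le_rfl⟩,
          hsw, Or.inr ⟨s, hsD, le_rfl, s', hss', hws'⟩⟩

end Extension

/-- A monotone family of semiintervals on a subset `D` of a linear order `D'` extends to a
monotone family of semiintervals of `D'` inducing it, and its powers, on `D`, and preserving
(exactly) its shifts. -/
theorem exists_monotone_extension_of_monotone_semiIntervalFamily {D' : Type*}
    [LinearOrder D'] (D : Set D') (S : D' → Set D')
    (hsub : ∀ x ∈ D, S x ⊆ D)
    (hconv : ∀ x ∈ D, ∀ a ∈ S x, ∀ b ∈ S x, ∀ c ∈ D, a ≤ c → c ≤ b → c ∈ S x)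
    (hmem : ∀ x ∈ D, x ∈ S x)
    (hmin : ∀ x ∈ D, ∀ y ∈ S x, x ≤ y)
    (hmono : ∀ x ∈ D, ∀ y ∈ D, x ≤ y → supinRel D (S x) ⊆ supinRel D (S y)) :
    ∃ R : D' → Set D',
      IsSemiIntervalFamily R ∧ IsMonotoneFamily R ∧
      (∀ x ∈ D, R x ∩ D = S x) ∧
      (∀ x ∈ D, ∀ n : ℕ, 1 ≤ n → famPow R n x ∩ D = famPow S n x) ∧
      (∀ x ∈ D, (IsShift R x ↔ IsShift S x)) := by
  have hR : ∀ {x : D'}, x ∈ D → ∀ (n : ℕ) {w : D'},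
      w ∈ famPow (semiIntervalExtension D S) n x ↔ x ≤ w ∧ ∃ s ∈ famPow S n x, w ≤ s :=
    fun hx n _ => mem_famPow_semiIntervalExtension_iff hsub hmem hmin hmono hx n
  have hinter : ∀ x ∈ D, ∀ n : ℕ,
      famPow (semiIntervalExtension D S) n x ∩ D = famPow S n x := by
    intro x hx n
    ext w
    constructor
    · rintro ⟨hw, hwD⟩
      obtain ⟨hxw, s, hs, hws⟩ := (hR hx n).mp hw
      exact mem_famPow_of_le hsub hconv hmem hx n hwD hxw hs hws
    · intro hw
      exact ⟨(hR hx n).mpr ⟨le_of_mem_famPow hsub hmin hx n hw, w, hw, le_rfl⟩,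
        famPow_subset_of_subset hsub hx n hw⟩
  refine ⟨semiIntervalExtension D S, isSemiIntervalFamily_semiIntervalExtension D S,
    isMonotoneFamily_semiIntervalExtension D S, fun x hx => ?_, fun x hx n _ => hinter x hx n,
    fun x hx => forall₂_congr fun n _ => ?_⟩
  · simpa [famPow] using hinter x hx 1
  · have hS : famPow S n x ⊆ famPow S (n + 1) x := famPow_subset_famPow_succ hsub hmem hx n
    have hE : famPow (semiIntervalExtension D S) n x ⊆
        famPow (semiIntervalExtension D S) (n + 1) x :=
      famPow_subset_famPow_succ (D := Set.univ) (S := semiIntervalExtension D S)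
        (fun _ _ => Set.subset_univ _)
        (fun z _ => ((isSemiIntervalFamily_semiIntervalExtension D S) z).2.1) (Set.mem_univ x) n
    rw [Set.ssubset_iff_subset_ne, Set.ssubset_iff_subset_ne, and_iff_right hE, and_iff_right hS,
      not_iff_not]
    constructor
    · intro h
      rw [← hinter x hx n, ← hinter x hx (n + 1), h]
    · intro h
      ext w
      rw [hR hx n, hR hx (n + 1), h]
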